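/- arXiv:1909.12548 — 10 statements merged into one kernel-verified Lean document; each statement's English description precedes it below -/
import Mathlib

section
/- For every n ≥ 1 the polynomial identity (u_n z + v_n)·X_{n+1}^{(ζ)}(z) = (u_n z² + s_n z − t_n)·X_n^{(ζ)}(z) − τ_{n−1}(u_{n+1} z + v_{n+1})·z·X_{n−1}^{(ζ)}(z) holds in ℂ[z]. Here the coefficients ω_n(ζ) are arbitrary nonzero complex numbers (no recursion on ω_n(ζ) is assumed). -/
open Polynomial

/-- the mixed recurrence
`(uₙ z + vₙ)·X_{n+1} = (uₙ z² + sₙ z − tₙ)·Xₙ − τ_{n−1}(u_{n+1} z + v_{n+1})·z·X_{n−1}`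
holds for all `n ≥ 1`, with arbitrary nonzero coefficients `ωₙ(ζ)`. -/
theorem stmt_0 (β τ ω : ℕ → ℂ) (ζ : ℂ)
    (hτ : ∀ n, τ n ≠ 0) (hω : ∀ n, ω n ≠ 0)
    (B Xp : ℕ → Polynomial ℂ)
    (hB0 : B 0 = 1)
    (hB1 : B 1 = X - C (β 0))
    (hBrec : ∀ n, B (n + 2) = (X - C (β (n + 1))) * B (n + 1) - C (τ (n + 1)) * X * B n)
    (hX0 : Xp 0 = 1)
    (hXsucc : ∀ n, Xp (n + 1) = B (n + 1) + C (ω (n + 1)) * B n)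
    (u v s t : ℕ → ℂ)
    (hu : ∀ n ≥ 1, u n = ω (n - 1) + τ (n - 1))
    (hv : ∀ n ≥ 1, v n = ω (n - 1) * (ω n - β (n - 1)))
    (hs : ∀ n ≥ 1, s n = (ω n)⁻¹ * u n * v (n + 1) + v n - ω (n - 1) * u (n + 1))
    (ht : ∀ n ≥ 1, t n = (ω n)⁻¹ * ω (n - 1) * β (n - 1) * v (n + 1)) :
    ∀ n ≥ 1,
      (C (u n) * X + C (v n)) * Xp (n + 1)
        = (C (u n) * X ^ 2 + C (s n) * X - C (t n)) * Xp n
          - C (τ (n - 1)) * (C (u (n + 1)) * X + C (v (n + 1))) * X * Xp (n - 1) := by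
  rintro n hn
  obtain ⟨m, rfl⟩ : ∃ m, n = m + 1 := ⟨n - 1, by omega⟩
  have hK : C (τ m) * X * Xp m
      = ((C (ω m) + C (τ m)) * X - C (ω m) * C (β m)) * B m - C (ω m) * B (m + 1) := by
    cases m with
    | zero => rw [hX0, hB0, hB1]; ring
    | succ k => rw [hXsucc, hBrec]; ring
  have hd : (ω (m + 1))⁻¹ * v (m + 2) = ω (m + 2) - β (m + 1) := by
    rw [hv (m + 2) (by omega)]
    have := hω (m + 1)
    simp only [Nat.add_sub_cancel, show m + 2 - 1 = m + 1 from rfl]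
    field_simp
  have e1 : u (m + 1) = ω m + τ m := hu (m + 1) (by omega)
  have e2 : u (m + 2) = ω (m + 1) + τ (m + 1) := hu (m + 2) (by omega)
  have e3 : v (m + 1) = ω m * (ω (m + 1) - β m) := hv (m + 1) (by omega)
  have e4 : v (m + 2) = ω (m + 1) * (ω (m + 2) - β (m + 1)) := hv (m + 2) (by omega)
  have e5 : s (m + 1) = (ω m + τ m) * (ω (m + 2) - β (m + 1)) + v (m + 1)
      - ω m * u (m + 2) := by
    have h : s (m + 1) = (ω (m + 1))⁻¹ * u (m + 1) * v (m + 2) + v (m + 1)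
      - ω m * u (m + 2) := hs (m + 1) (by omega)
    rw [h, ← hd, e1]; ring
  have e6 : t (m + 1) = ω m * β m * (ω (m + 2) - β (m + 1)) := by
    have h : t (m + 1) = (ω (m + 1))⁻¹ * ω m * β m * v (m + 2) := ht (m + 1) (by omega)
    rw [h, ← hd]; ring
  simp only [Nat.add_sub_cancel, show m + 1 + 1 = m + 2 from rfl]
  rw [hXsucc (m + 1), hXsucc m, hBrec m, e5, e6, e1, e2, e3, e4]
  simp only [C_add, C_sub, C_mul]
  linear_combination ((C (ω (m + 1)) + C (τ (m + 1))) * X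
    + C (ω (m + 1)) * (C (ω (m + 2)) - C (β (m + 1)))) * hK
end

section
/- Suppose ω_0(ζ) = −τ_0 ≠ 0, ω_1(ζ) ≠ β_0, ω_n(ζ) ≠ 0 for all n, the recursion ω_{n+1}(ζ) = ((β_n − ζ)ω_n(ζ) − τ_n ζ)/ω_n(ζ) holds for n ≥ 1, and ω_{n−1}(ζ) ≠ −τ_{n−1} (i.e. u_n ≠ 0) for all n ≥ 2. Then the following polynomial identities hold in ℂ[z]: for n ≥ 2, X_{n+1}^{(ζ)}(z) = (z − u_{n+1}ω_{n−1}(ζ)β_{n−1}/(u_n ω_n(ζ)))·X_n^{(ζ)}(z) − (u_{n+1}/u_n)·τ_{n−1}·z·X_{n−1}^{(ζ)}(z); and for n = 1, v_1·X_2^{(ζ)}(z) = (s_1 z − t_1)·X_1^{(ζ)}(z) − τ_0 u_2 · z(z − ζ), where X_1^{(ζ)}(z) = z + ω_1(ζ) − β_0 and v_1 = −τ_0(ω_1(ζ) − β_0) ≠ 0. -/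
open Polynomial

/-- under the recursion for `ωₙ(ζ)` (with `ω₀(ζ) = −τ₀`,
`ω₁(ζ) ≠ β₀`, `ωₙ(ζ) ≠ 0`, and `uₙ ≠ 0` for `n ≥ 2`), the simplified
`R_I`-type recurrence holds for `n ≥ 2`, together with the special identity at `n = 1`. -/
theorem stmt_2 (β τ ω : ℕ → ℂ) (ζ : ℂ)
    (hτ : ∀ n, τ n ≠ 0) (hω : ∀ n, ω n ≠ 0)
    (hω0 : ω 0 = -τ 0) (hω1 : ω 1 ≠ β 0)
    (hrec : ∀ n ≥ 1, ω (n + 1) = ((β n - ζ) * ω n - τ n * ζ) / ω n)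
    (B Xp : ℕ → Polynomial ℂ)
    (hB0 : B 0 = 1)
    (hB1 : B 1 = X - C (β 0))
    (hBrec : ∀ n, B (n + 2) = (X - C (β (n + 1))) * B (n + 1) - C (τ (n + 1)) * X * B n)
    (hX0 : Xp 0 = 1)
    (hXsucc : ∀ n, Xp (n + 1) = B (n + 1) + C (ω (n + 1)) * B n)
    (u v s t : ℕ → ℂ)
    (hu : ∀ n ≥ 1, u n = ω (n - 1) + τ (n - 1))
    (hv : ∀ n ≥ 1, v n = ω (n - 1) * (ω n - β (n - 1)))
    (hs : ∀ n ≥ 1, s n = (ω n)⁻¹ * u n * v (n + 1) + v n - ω (n - 1) * u (n + 1))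
    (ht : ∀ n ≥ 1, t n = (ω n)⁻¹ * ω (n - 1) * β (n - 1) * v (n + 1))
    (hune : ∀ n ≥ 2, u n ≠ 0) :
    (∀ n ≥ 2,
      Xp (n + 1)
        = (X - C (u (n + 1) * ω (n - 1) * β (n - 1) / (u n * ω n))) * Xp n
          - C (u (n + 1) / u n * τ (n - 1)) * X * Xp (n - 1)) ∧
    (C (v 1) * Xp 2 = (C (s 1) * X - C (t 1)) * Xp 1 - C (τ 0 * u 2) * (X * (X - C ζ))) ∧
    Xp 1 = X + C (ω 1 - β 0) ∧
    v 1 = -τ 0 * (ω 1 - β 0) ∧ v 1 ≠ 0 := by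
  have hr : ∀ n ≥ 1, ω n * (ω (n + 1) - β n) = -ζ * (ω n + τ n) := by
    intro n hn
    have h0 := hω n
    rw [hrec n hn]
    field_simp
    ring
  have hX1 : Xp 1 = X + C (ω 1 - β 0) := by
    rw [hXsucc 0, zero_add, hB0, hB1, C_sub]
    ring
  have hv1 : v 1 = -τ 0 * (ω 1 - β 0) := by
    rw [hv 1 le_rfl, ← hω0]
  refine ⟨?_, ?_, hX1, hv1, ?_⟩
  · intro n hn
    obtain ⟨k, rfl⟩ := Nat.exists_eq_add_of_le' hn
    have e1 : k + 2 - 1 = k + 1 := rfl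
    rw [e1]
    have hu2 : u (k + 2) = ω (k + 1) + τ (k + 1) := hu (k + 2) (by omega)
    have hu3 : u (k + 2 + 1) = ω (k + 2) + τ (k + 2) := hu (k + 3) (by omega)
    have hn2 := hune (k + 2) hn
    have h2 := hω (k + 2)
    have r1 := hr (k + 1) (by omega)
    have r2 := hr (k + 2) (by omega)
    simp only [show k + 1 + 1 = k + 2 from rfl] at r1
    have ha : u (k + 2 + 1) * ω (k + 1) * β (k + 1) / (u (k + 2) * ω (k + 2)) * ω (k + 2)
        = u (k + 2 + 1) / u (k + 2) * (ω (k + 1) * β (k + 1)) := by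
      field_simp
    have hru : u (k + 2 + 1) / u (k + 2) * u (k + 2) = u (k + 2 + 1) := by
      field_simp
    generalize u (k + 2 + 1) * ω (k + 1) * β (k + 1) / (u (k + 2) * ω (k + 2)) = a at *
    generalize u (k + 2 + 1) / u (k + 2) = r at *
    have hb : -a + r * ω (k + 1) = ω (k + 2 + 1) - β (k + 2) := by
      apply mul_left_cancel₀ h2
      rw [hu2, hu3] at hru
      linear_combination -ha + r * r1 - r2 - ζ * hru
    rw [hu2, hu3] at hru
    have x3 := hXsucc (k + 2)
    have x2 : Xp (k + 2) = _ := hXsucc (k + 1)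
    have x1 := hXsucc k
    have b3 : B (k + 2 + 1) = _ := hBrec (k + 1)
    have b2 := hBrec k
    apply Polynomial.funext
    intro z
    rw [x3, x2, x1, b3]
    simp only [show k + 1 + 1 = k + 2 from rfl]
    have b2' := congrArg (eval z) b2
    simp only [eval_add, eval_sub, eval_mul, eval_C, eval_X] at b2' ⊢
    linear_combination (-(eval z (B (k + 2)))) * hb + (z * eval z (B (k + 1))) * hru
      + eval z (B (k + 1)) * ha + r * ω (k + 1) * b2'
  · have hu1 : u 1 = 0 := by rw [hu 1 le_rfl]; simp [hω0]
    have hu2 : u 2 = ω 1 + τ 1 := hu 2 (by omega)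
    have hv2 : v 2 = -ζ * (ω 1 + τ 1) := by
      rw [← hr 1 le_rfl]; exact hv 2 (by omega)
    have hs1 : s 1 = v 1 + τ 0 * u 2 := by
      have := hs 1 le_rfl
      simp only [hu1, Nat.sub_self, hω0] at this
      rw [this]; ring
    have ht1 : t 1 = (ω 1)⁻¹ * (-τ 0) * β 0 * v 2 := by
      have := ht 1 le_rfl
      simpa only [Nat.sub_self, hω0] using this
    have h1 := hω 1
    have w2 : ω 2 = β 1 - ζ * (ω 1 + τ 1) / ω 1 := by
      have := hr 1 le_rfl
      simp only [show 1 + 1 = 2 from rfl] at this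
      field_simp
      linear_combination this
    have x2 : Xp 2 = _ := hXsucc 1
    have b2 : B 2 = _ := hBrec 0
    apply Polynomial.funext
    intro z
    rw [x2, hX1]
    simp only [show 1 + 1 = 2 from rfl, b2, zero_add, hB0, hB1]
    simp only [eval_add, eval_sub, eval_mul, eval_C, eval_X, eval_one]
    rw [hs1, ht1, hv1, hv2, hu2, w2]
    field_simp
    ring
  · rw [hv1]
    exact mul_ne_zero (neg_ne_zero.mpr (hτ 0)) (sub_ne_zero.mpr hω1)
end

section
/- Assume in addition that β_n ≠ 0 for all n and X_n^{(ζ)}(0) ≠ 0 for all n ≥ 1. Then there exist complex numbers f_{n,ζ} (n ≥ 1) such that the sequence {X_n^{(ζ)}} satisfies the R_I-type recurrence X_{n+1}^{(ζ)}(z) = (z + v_{n+1}/ω_n(ζ) − ω_{n−1}(ζ)f_{n,ζ})·X_n^{(ζ)}(z) − τ_{n−1} f_{n,ζ}·z·X_{n−1}^{(ζ)}(z) for all n ≥ 1, if and only if there exist complex numbers f_{n,ζ} (n ≥ 1) such that for all n ≥ 1 both of the following hold: (1 − β_n/ω_{n+1}(ζ))·(β_{n−1}/ω_n(ζ)) =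 (β_{n−1}ω_{n−1}(ζ)f_{n,ζ}/(β_n ω_n(ζ)))·(1 − β_{n−1}/ω_n(ζ))·(β_n/ω_{n+1}(ζ)), and (1 + τ_n/ω_n(ζ))·(τ_{n−1}/ω_{n−1}(ζ)) = (τ_{n−1}f_{n,ζ}/τ_n)·(1 + τ_{n−1}/ω_{n−1}(ζ))·(τ_n/ω_n(ζ)). -/
open Polynomial

/-- `{Xₙ}` satisfies an `R_I`-type recurrence with coefficients
`f_{n,ζ}` if and only if the two "chain sequence" conditions of
Theorem 2.2 of the paper hold. -/
theorem stmt_3 (β τ ω : ℕ → ℂ) (ζ : ℂ)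
    (hτ : ∀ n, τ n ≠ 0) (hω : ∀ n, ω n ≠ 0) (hβ : ∀ n, β n ≠ 0)
    (B Xp : ℕ → Polynomial ℂ)
    (hB0 : B 0 = 1)
    (hB1 : B 1 = X - C (β 0))
    (hBrec : ∀ n, B (n + 2) = (X - C (β (n + 1))) * B (n + 1) - C (τ (n + 1)) * X * B n)
    (hX0 : Xp 0 = 1)
    (hXsucc : ∀ n, Xp (n + 1) = B (n + 1) + C (ω (n + 1)) * B n)
    (u v : ℕ → ℂ)
    (hu : ∀ n ≥ 1, u n = ω (n - 1) + τ (n - 1))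
    (hv : ∀ n ≥ 1, v n = ω (n - 1) * (ω n - β (n - 1)))
    (hX0ne : ∀ n ≥ 1, (Xp n).eval 0 ≠ 0) :
    (∃ f : ℕ → ℂ, ∀ n ≥ 1,
        Xp (n + 1)
          = (X + C (v (n + 1) / ω n - ω (n - 1) * f n)) * Xp n
            - C (τ (n - 1) * f n) * X * Xp (n - 1)) ↔
    (∃ f : ℕ → ℂ, ∀ n ≥ 1,
        (1 - β n / ω (n + 1)) * (β (n - 1) / ω n)
          = β (n - 1) * ω (n - 1) * f n / (β n * ω n)
            * ((1 - β (n - 1) / ω n) * (β n / ω (n + 1))) ∧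
        (1 + τ n / ω n) * (τ (n - 1) / ω (n - 1))
          = τ (n - 1) * f n / τ n
            * ((1 + τ (n - 1) / ω (n - 1)) * (τ n / ω n))) := by
  have hBne : ∀ n, B n ≠ 0 := by
    have h : ∀ n, (B n).eval 0 ≠ 0 := by
      intro n
      induction n with
      | zero => simp [hB0]
      | succ k ih =>
        cases k with
        | zero => simpa [hB1] using hβ 0
        | succ m =>
          rw [hBrec]
          simpa using ⟨hβ (m + 1), ih⟩
    intro n hn
    exact h n (by simp [hn])
  have hW : ∀ n, ∃ W : Polynomial ℂ, B (n + 1) = (X - C (β n)) * B n - C (τ n) * X * W ∧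
      Xp n = B n + C (ω n) * W := by
    intro n
    cases n with
    | zero => exact ⟨0, by simp [hB0, hB1], by simp [hB0, hX0]⟩
    | succ m => exact ⟨B m, hBrec m, hXsucc m⟩
  refine exists_congr fun f => forall_congr' fun n => ?_
  cases n with
  | zero => simp
  | succ m =>
    refine forall_congr' fun _ => ?_
    simp only [Nat.add_sub_cancel]
    rw [hv (m + 1 + 1) (by omega)]
    simp only [Nat.add_sub_cancel]
    have h0 := hω m
    have h1 := hω (m + 1)
    have h2 := hω (m + 1 + 1)
    have hb0 := hβ m
    have hb1 := hβ (m + 1)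
    have ht0 := hτ m
    have ht1 := hτ (m + 1)
    rw [mul_div_cancel_left₀ _ h1]
    set g := f (m + 1)
    set a : ℂ := ω (m + 1) + τ (m + 1) - g * (ω m + τ m) with ha
    set b : ℂ := ω (m + 1) * (ω (m + 1 + 1) - β (m + 1)) - g * (ω m * (ω (m + 1) - β m)) with hb
    have key : (X + C (ω (m + 1 + 1) - β (m + 1) - ω m * g)) * Xp (m + 1)
        - C (τ m * g) * X * Xp m - Xp (m + 1 + 1) = (C a * X + C b) * B m := by
      obtain ⟨W, hW1, hW2⟩ := hW m
      rw [hXsucc (m + 1), hBrec m, hXsucc m, hW2, ha, hb]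
      simp only [C_add, C_sub, C_mul]
      linear_combination (-(C (ω m) * C g)) * hW1
    have e1 : (Xp (m + 1 + 1) = (X + C (ω (m + 1 + 1) - β (m + 1) - ω m * g)) * Xp (m + 1)
        - C (τ m * g) * X * Xp m) ↔ (b = 0 ∧ a = 0) := by
      rw [eq_comm, ← sub_eq_zero, key, mul_eq_zero, or_iff_left (hBne m)]
      constructor
      · intro h
        have c0 := congrArg (fun p => Polynomial.coeff p 0) h
        have c1 := congrArg (fun p => Polynomial.coeff p 1) h
        simp [coeff_C] at c0 c1
        exact ⟨c0, c1⟩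
      · rintro ⟨h, h'⟩
        simp [h, h']
    rw [e1]
    refine and_congr ?_ ?_
    · rw [← sub_eq_zero (a := (1 - β (m + 1) / ω (m + 1 + 1)) * _)]
      have : (1 - β (m + 1) / ω (m + 1 + 1)) * (β m / ω (m + 1)) -
          β m * ω m * g / (β (m + 1) * ω (m + 1)) *
            ((1 - β m / ω (m + 1)) * (β (m + 1) / ω (m + 1 + 1)))
          = b * (β m / (ω (m + 1) ^ 2 * ω (m + 1 + 1))) := by
        rw [hb]; field_simp
      rw [this, mul_eq_zero, or_iff_left]
      positivity
    · rw [← sub_eq_zero (a := (1 + τ (m + 1) / ω (m + 1)) * _)]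
      have : (1 + τ (m + 1) / ω (m + 1)) * (τ m / ω m) -
          τ m * g / τ (m + 1) * ((1 + τ m / ω m) * (τ (m + 1) / ω (m + 1)))
          = a * (τ m / (ω m * ω (m + 1))) := by
        rw [ha]; field_simp; try ring
      rw [this, mul_eq_zero, or_iff_left]
      positivity
end

section
/- Suppose ω_n(ζ) = −τ_n for all n ≥ 0 and that v_n := τ_{n−1}(τ_n + β_{n−1}) ≠ 0 for all n ≥ 1. Then for all n ≥ 1 the polynomial identity X_{n+1}^{(ζ)}(z) = (z − τ_{n−1} v_{n+1} β_{n−1}/(τ_n v_n))·X_n^{(ζ)}(z) − (v_{n+1}/v_n)·τ_{n−1}·z·X_{n−1}^{(ζ)}(z) holds, with X_0^{(ζ)}(z) = 1 and X_1^{(ζ)}(z) = z − τ_1 − β_0. -/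
open Polynomial

/-- if `ωₙ(ζ) = −τₙ` for all `n` and
`vₙ := τ_{n−1}(τₙ + β_{n−1}) ≠ 0`, then the `R_I`-type recurrence of
Corollary 2.3 of the paper holds. -/
theorem stmt_4 (β τ ω : ℕ → ℂ) (ζ : ℂ)
    (hτ : ∀ n, τ n ≠ 0) (hω : ∀ n, ω n ≠ 0)
    (hωτ : ∀ n, ω n = -τ n)
    (B Xp : ℕ → Polynomial ℂ)
    (hB0 : B 0 = 1)
    (hB1 : B 1 = X - C (β 0))
    (hBrec : ∀ n, B (n + 2) = (X - C (β (n + 1))) * B (n + 1) - C (τ (n + 1)) * X * B n)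
    (hX0 : Xp 0 = 1)
    (hXsucc : ∀ n, Xp (n + 1) = B (n + 1) + C (ω (n + 1)) * B n)
    (v : ℕ → ℂ)
    (hv : ∀ n ≥ 1, v n = τ (n - 1) * (τ n + β (n - 1)))
    (hvne : ∀ n ≥ 1, v n ≠ 0) :
    (∀ n ≥ 1,
      Xp (n + 1)
        = (X - C (τ (n - 1) * v (n + 1) * β (n - 1) / (τ n * v n))) * Xp n
          - C (v (n + 1) / v n * τ (n - 1)) * X * Xp (n - 1)) ∧
    Xp 0 = 1 ∧ Xp 1 = X - C (τ 1) - C (β 0) := by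
  have key : ∀ n, ∃ r : ℂ, r * (τ (n + 1) + β n) = τ (n + 2) + β (n + 1) ∧
      τ n * v (n + 2) * β n / (τ (n + 1) * v (n + 1)) = r * β n ∧
      v (n + 2) / v (n + 1) * τ n = τ (n + 1) * r := by
    intro n
    have h1 := hv (n + 1) (by omega)
    have h2 := hv (n + 2) (by omega)
    have h3 := hvne (n + 1) (by omega)
    rw [show n + 1 - 1 = n by omega] at h1
    rw [show n + 2 - 1 = n + 1 by omega] at h2
    have h4 : τ (n + 1) + β n ≠ 0 := by
      intro h
      apply h3
      rw [h1, h, mul_zero]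
    have h5 := hτ n
    have h6 := hτ (n + 1)
    refine ⟨(τ (n + 2) + β (n + 1)) / (τ (n + 1) + β n), ?_, ?_, ?_⟩
    · field_simp
    · rw [h1, h2]
      field_simp
    · rw [h1, h2]
      field_simp
  refine ⟨?_, hX0, ?_⟩
  · intro n hn
    obtain ⟨m, rfl⟩ : ∃ m, n = m + 1 := ⟨n - 1, by omega⟩
    obtain ⟨r, hr, ha, hb⟩ := key m
    rw [show m + 1 - 1 = m by omega, show m + 1 + 1 = m + 2 by omega, ha, hb]
    have hr' := congrArg (C : ℂ → ℂ[X]) hr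
    simp only [C_mul, C_add] at hr'
    have e1 := hXsucc (m + 1)
    have e2 := hXsucc m
    have e3 := hBrec m
    rw [show m + 1 + 1 = m + 2 by omega] at e1
    rw [e1, e2, e3, hωτ, hωτ]
    cases m with
    | zero =>
      simp only [C_mul, C_neg, Nat.zero_add] at *
      rw [hX0, hB0, hB1]
      linear_combination (X - C (β 0)) * hr'
    | succ k =>
      have e4 := hXsucc k
      have e5 := hBrec k
      rw [e4, hωτ]
      simp only [C_mul, C_neg, Nat.add_assoc, Nat.reduceAdd] at *
      linear_combination B (k + 2) * hr' - C (τ (k + 2)) * C r * e5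
  · rw [hXsucc 0, hωτ, hB0, hB1]
    simp only [C_neg, Nat.zero_add]
    ring
end

section
/- For every n ≥ 0 the polynomial identity (u_{n+1} z + v_{n+1})·B_n(z) = ω_n(ζ)·X_{n+1}^{(ζ)}(z) + τ_n·z·X_n^{(ζ)}(z) holds in ℂ[z]. Consequently, if u_{n+1} ≠ 0 and z_0 = −v_{n+1}/u_{n+1}, then X_{n+1}^{(ζ)}(z_0) = (v_{n+1}/u_{n+1})·(τ_n/ω_n(ζ))·X_n^{(ζ)}(z_0). -/
open Polynomial

/-- the identity
`(u_{n+1} z + v_{n+1})·Bₙ(z) = ωₙ(ζ)·X_{n+1}(z) + τₙ·z·Xₙ(z)` holds for all `n ≥ 0`;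
consequently, at `z₀ = −v_{n+1}/u_{n+1}` (when `u_{n+1} ≠ 0`) one has
`X_{n+1}(z₀) = (v_{n+1}/u_{n+1})·(τₙ/ωₙ(ζ))·Xₙ(z₀)`. -/
theorem stmt_5 (β τ ω : ℕ → ℂ) (ζ : ℂ)
    (hτ : ∀ n, τ n ≠ 0) (hω : ∀ n, ω n ≠ 0)
    (B Xp : ℕ → Polynomial ℂ)
    (hB0 : B 0 = 1)
    (hB1 : B 1 = X - C (β 0))
    (hBrec : ∀ n, B (n + 2) = (X - C (β (n + 1))) * B (n + 1) - C (τ (n + 1)) * X * B n)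
    (hX0 : Xp 0 = 1)
    (hXsucc : ∀ n, Xp (n + 1) = B (n + 1) + C (ω (n + 1)) * B n)
    (u v : ℕ → ℂ)
    (hu : ∀ n ≥ 1, u n = ω (n - 1) + τ (n - 1))
    (hv : ∀ n ≥ 1, v n = ω (n - 1) * (ω n - β (n - 1))) :
    (∀ n : ℕ,
      (C (u (n + 1)) * X + C (v (n + 1))) * B n
        = C (ω n) * Xp (n + 1) + C (τ n) * X * Xp n) ∧
    (∀ n : ℕ, u (n + 1) ≠ 0 →
      (Xp (n + 1)).eval (-(v (n + 1)) / u (n + 1))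
        = v (n + 1) / u (n + 1) * (τ n / ω n)
          * (Xp n).eval (-(v (n + 1)) / u (n + 1))) := by
  have key : ∀ n : ℕ,
      (C (u (n + 1)) * X + C (v (n + 1))) * B n
        = C (ω n) * Xp (n + 1) + C (τ n) * X * Xp n := by
    intro n
    rw [hu (n + 1) (by omega), hv (n + 1) (by omega)]
    simp only [Nat.add_sub_cancel, C_add, C_mul, C_sub]
    cases n with
    | zero =>
      rw [hXsucc, hX0]
      simp only [zero_add, hB0, hB1]
      ring
    | succ k =>
      rw [hXsucc, hXsucc, hBrec]
      ring
  refine ⟨key, fun n hn => ?_⟩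
  have h := congrArg (Polynomial.eval (-(v (n + 1)) / u (n + 1))) (key n)
  simp only [eval_mul, eval_add, eval_C, eval_X] at h
  have h0 : u (n + 1) * (-(v (n + 1)) / u (n + 1)) + v (n + 1) = 0 := by
    field_simp
    ring
  rw [h0, zero_mul] at h
  have hw := hω n
  apply mul_left_cancel₀ hw
  have e : ω n * (v (n + 1) / u (n + 1) * (τ n / ω n)
      * (Xp n).eval (-(v (n + 1)) / u (n + 1)))
      = -(τ n * (-(v (n + 1)) / u (n + 1)) * (Xp n).eval (-(v (n + 1)) / u (n + 1))) := by
    generalize (Xp n).eval (-(v (n + 1)) / u (n + 1)) = a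
    field_simp
  rw [e]
  linear_combination -h
end

section
/- Let L be a ℂ-linear functional on the Laurent polynomials ℂ[z, z^{−1}] such that L(z^{−j}B_n(z)) = 0 for all n ≥ 1 and all 1 ≤ j ≤ n. Fix ζ, α, λ ∈ ℂ with λ ≠ 1 and ζ ≠ 0, and set e = (ζ − α)/(1 − λ). Define B_{n−1}^{(1)}(ζ) := L((B_n(z) − B_n(ζ))/(z − ζ)) for n ≥ 1 and B_{−1}^{(1)}(ζ) := 0, and r_n(ζ) := (1 − λ)B_n(ζ) − (ζ − α)B_{n−1}^{(1)}(ζ); assume r_n(ζ) ≠ 0 for all n ≥ 0, and set ω_{n+1}(ζ) := −r_{n+1}(ζ)/r_n(ζ). Define the linear functional M on ℂ[z, z^{−1}] by M(P) := P(ζ) − e·L((P(z) − P(ζ))/(z − ζ)). Then M(z^{−j}·X_{n+1}^{(ζ)}(z)) = 0 for all n ≥ 0 and all j = 0, 1, …, n. -/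
open Polynomial

/-- if `L` annihilates `z^{−j}·Bₙ(z)` for `1 ≤ j ≤ n`, and
`M(P) = P(ζ) − e·L((P(z) − P(ζ))/(z − ζ))` with `e = (ζ − α)/(1 − λ)` and
`ω_{n+1}(ζ) = −r_{n+1}(ζ)/rₙ(ζ)`, then `M(z^{−j}·X_{n+1}(z)) = 0` for
`0 ≤ j ≤ n`.  Here evaluation of Laurent polynomials at `ζ ≠ 0` is encoded by
the `ℂ`-algebra map `ev` with `ev (T 1) = ζ`, and the divided difference by the
unique quotient `Q` with `(T 1 − C ζ)·Q = P − C (ev P)`. -/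
theorem stmt_6 (β τ : ℕ → ℂ) (ζ α lam : ℂ)
    (hτ : ∀ n, τ n ≠ 0) (hζ : ζ ≠ 0) (hlam : lam ≠ 1)
    (e : ℂ) (he : e = (ζ - α) / (1 - lam))
    (B : ℕ → Polynomial ℂ)
    (hB0 : B 0 = 1)
    (hB1 : B 1 = X - C (β 0))
    (hBrec : ∀ n, B (n + 2) = (X - C (β (n + 1))) * B (n + 1) - C (τ (n + 1)) * X * B n)
    (L : LaurentPolynomial ℂ →ₗ[ℂ] ℂ)
    (hL : ∀ n ≥ 1, ∀ j : ℕ, 1 ≤ j → j ≤ n →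
      L (LaurentPolynomial.T (-(j : ℤ)) * (B n).toLaurent) = 0)
    -- `Bo n` is the associated polynomial value `B_{n−1}^{(1)}(ζ)`
    (Bo : ℕ → ℂ) (hBo0 : Bo 0 = 0)
    (hBo : ∀ n ≥ 1, ∀ Q : Polynomial ℂ,
      (X - C ζ) * Q = B n - C ((B n).eval ζ) → Bo n = L Q.toLaurent)
    (r : ℕ → ℂ)
    (hr : ∀ n, r n = (1 - lam) * (B n).eval ζ - (ζ - α) * Bo n)
    (hrne : ∀ n, r n ≠ 0)
    (ω : ℕ → ℂ)
    (hω : ∀ n, ω (n + 1) = -(r (n + 1) / r n))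
    (Xp : ℕ → Polynomial ℂ)
    (hX0 : Xp 0 = 1)
    (hXsucc : ∀ n, Xp (n + 1) = B (n + 1) + C (ω (n + 1)) * B n)
    -- evaluation at `ζ` of Laurent polynomials
    (ev : LaurentPolynomial ℂ →ₐ[ℂ] ℂ)
    (hev : ev (LaurentPolynomial.T 1) = ζ)
    -- the transformed functional `M`
    (M : LaurentPolynomial ℂ →ₗ[ℂ] ℂ)
    (hM : ∀ P Q : LaurentPolynomial ℂ,
      (LaurentPolynomial.T 1 - LaurentPolynomial.C ζ) * Q = P - LaurentPolynomial.C (ev P) →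
      M P = ev P - e * L Q) :
    ∀ n : ℕ, ∀ j : ℕ, j ≤ n →
      M (LaurentPolynomial.T (-(j : ℤ)) * (Xp (n + 1)).toLaurent) = 0 := by
  have hevp : ∀ p : Polynomial ℂ, ev p.toLaurent = p.eval ζ := by
    intro p
    have h : ev.comp (Polynomial.toLaurentAlg (R := ℂ)) = Polynomial.aeval ζ := by
      apply Polynomial.algHom_ext
      simp [hev]
    have h2 := DFunLike.congr_fun h p
    simpa [Polynomial.coe_aeval_eq_eval] using h2
  have hevC : ∀ c : ℂ, ev (LaurentPolynomial.C c) = c := by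
    intro c
    have := hevp (C c)
    simpa using this
  have hq : ∀ p : Polynomial ℂ, ∃ Q : Polynomial ℂ, (X - C ζ) * Q = p - C (p.eval ζ) := by
    intro p
    obtain ⟨Q, hQ⟩ := Polynomial.X_sub_C_dvd_sub_C_eval (a := ζ) (p := p)
    exact ⟨Q, hQ.symm⟩
  have hqL : ∀ p Q : Polynomial ℂ, (X - C ζ) * Q = p - C (p.eval ζ) →
      (LaurentPolynomial.T 1 - LaurentPolynomial.C ζ) * Q.toLaurent
        = p.toLaurent - LaurentPolynomial.C (ev p.toLaurent) := by
    intro p Q h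
    have h2 := congrArg Polynomial.toLaurent h
    rw [hevp]
    simpa using h2
  have hl : (1 - lam) ≠ 0 := sub_ne_zero.mpr (Ne.symm hlam)
  have hMB : ∀ n, M (B n).toLaurent = r n / (1 - lam) := by
    intro n
    obtain ⟨Q, hQ⟩ := hq (B n)
    have h1 := hM _ _ (hqL _ _ hQ)
    have h2 : Bo n = L Q.toLaurent := by
      rcases Nat.eq_zero_or_pos n with h | h
      · subst h
        rw [hB0] at hQ
        simp [Polynomial.X_sub_C_ne_zero] at hQ
        simp [hQ, hBo0]
      · exact hBo n h Q hQ
    rw [h1, hevp, ← h2, hr, he]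
    field_simp
  intro n
  have key : ∀ j : ℕ, j ≤ n →
      M (LaurentPolynomial.T (-(j : ℤ)) * (Xp (n + 1)).toLaurent) = 0 ∧
      ∃ Q, (LaurentPolynomial.T 1 - LaurentPolynomial.C ζ) * Q =
        LaurentPolynomial.T (-(j : ℤ)) * (Xp (n + 1)).toLaurent -
        LaurentPolynomial.C (ev (LaurentPolynomial.T (-(j : ℤ)) * (Xp (n + 1)).toLaurent)) := by
    intro j
    induction j with
    | zero =>
      intro _
      simp only [Nat.cast_zero, neg_zero, LaurentPolynomial.T_zero, one_mul]
      constructor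
      · rw [hXsucc, map_add, map_mul, map_add, Polynomial.toLaurent_C,
          ← LaurentPolynomial.smul_eq_C_mul, map_smul, hMB, hMB, hω, smul_eq_mul]
        have := hrne n
        field_simp
        ring
      · obtain ⟨Q, hQ⟩ := hq (Xp (n + 1))
        exact ⟨_, hqL _ _ hQ⟩
    | succ j ih =>
      intro hj
      obtain ⟨h0, Q, hQ⟩ := ih (by omega)
      have hLP : L (LaurentPolynomial.T (-((j + 1 : ℕ) : ℤ)) * (Xp (n + 1)).toLaurent) = 0 := by
        rw [hXsucc, map_add, map_mul Polynomial.toLaurent, Polynomial.toLaurent_C, mul_add, mul_left_comm,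
          ← LaurentPolynomial.smul_eq_C_mul, map_add, map_smul,
          hL (n + 1) (by omega) (j + 1) (by omega) (by omega),
          hL n (by omega) (j + 1) (by omega) (by omega)]
        simp
      have hP : LaurentPolynomial.T (-(j : ℤ)) * (Xp (n + 1)).toLaurent =
          LaurentPolynomial.T 1 *
          (LaurentPolynomial.T (-((j + 1 : ℕ) : ℤ)) * (Xp (n + 1)).toLaurent) := by
        rw [← mul_assoc, ← LaurentPolynomial.T_add]
        congr 2
        push_cast
        ring
      have hM0 := hM _ _ hQ
      rw [h0] at hM0
      rw [hP] at hQ hM0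
      generalize LaurentPolynomial.T (-((j + 1 : ℕ) : ℤ)) * (Xp (n + 1)).toLaurent = P at *
      rw [map_mul, hev] at hQ hM0
      have hCC : LaurentPolynomial.C ζ⁻¹ * LaurentPolynomial.C ζ = 1 := by
        rw [← map_mul, inv_mul_cancel₀ hζ, map_one]
      have hQ' : (LaurentPolynomial.T 1 - LaurentPolynomial.C ζ) *
          (LaurentPolynomial.C ζ⁻¹ * (Q - P)) = P - LaurentPolynomial.C (ev P) := by
        rw [map_mul] at hQ
        linear_combination LaurentPolynomial.C ζ⁻¹ * hQ +
          (P - LaurentPolynomial.C (ev P)) * hCC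
      refine ⟨?_, _, hQ'⟩
      rw [hM _ _ hQ', ← LaurentPolynomial.smul_eq_C_mul, map_smul, map_sub, hLP, smul_eq_mul]
      field_simp
      linear_combination -hM0
  intro j hj
  exact (key j hj).1
end

section
/- Let O be a ℂ-linear functional on ℂ[z, z^{−1}], and let x_{n0}, λ_n, υ̂_n, υ̃_n be complex numbers with x_{n0} ≠ 0 and υ̂_n² ≠ υ̃_n². For each n ≥ 0 let X̂_n be a polynomial of degree n with constant term 1 and X̃_n a monic polynomial of degree n, satisfying O(X̂_n z^{−k}) = υ̂_n/x_{n0}, 0, −υ̃_n/x_{n0} and O(X̃_n z^{−k}) = υ̃_n/x_{n0}, 0, −υ̂_n/x_{n0} according as k = 0, k ∈ {1, …, n−1}, k = n. Define σ̂_n = x_{n0}λ_n υ̂_n/(υ̂_n² − υ̃_n²), σ̃_n = x_{n0}λ_n υ̃_n/(υ̂_n² − υ̃_n²), and assume the coefficient relations x̂_{nn} = (σ̂_n + 1)/σ̃_n and x̃_{n0} = (σ̂_n − 1)/σ̃_n for the leading coefficient x̂_{nn} of X̂_n and the constant term x̃_{n0} of X̃_n (σ̃_n ≠ 0). Put Û_n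 = σ̂_n X̂_n − σ̃_n X̃_n and Ũ_n = σ̃_n X̂_n − σ̂_n X̃_n. Then: (a) Û_n has constant term 1 and Ũ_n is monic of degree n; (b) O(z^{k−n}·Û_n(z)) = O(Ũ_n(z)·z^{−k}) = 0 for k = 0, …, n−1 and both equal λ_n for k = n; (c) O(Ũ_m(z)·z^{−n}·Û_n(z)) = λ_n δ_{m,n} for all m, n ≥ 0 (biorthogonality). -/
open Polynomial

lemma O_mul_toLaurent (O : LaurentPolynomial ℂ →ₗ[ℂ] ℂ) (A : LaurentPolynomial ℂ)
    (p : Polynomial ℂ) (N : ℕ) (hp : p.natDegree ≤ N) :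
    O (A * p.toLaurent) = ∑ i ∈ Finset.range (N + 1),
      p.coeff i * O (A * LaurentPolynomial.T (i : ℤ)) := by
  conv_lhs => rw [p.as_sum_range' (N + 1) (by omega)]
  rw [map_sum, Finset.mul_sum, map_sum]
  refine Finset.sum_congr rfl fun i _ => ?_
  rw [Polynomial.toLaurent_C_mul_T, ← LaurentPolynomial.smul_eq_C_mul, mul_smul_comm, map_smul,
    smul_eq_mul]

lemma O_comb (O : LaurentPolynomial ℂ →ₗ[ℂ] ℂ) (A : LaurentPolynomial ℂ)
    (p q : Polynomial ℂ) (a b : ℂ) :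
    O ((C a * p - C b * q).toLaurent * A) = a * O (p.toLaurent * A) - b * O (q.toLaurent * A) := by
  rw [map_sub, map_mul toLaurent, map_mul toLaurent, Polynomial.toLaurent_C, Polynomial.toLaurent_C,
    ← LaurentPolynomial.smul_eq_C_mul, ← LaurentPolynomial.smul_eq_C_mul, sub_mul,
    smul_mul_assoc, smul_mul_assoc, map_sub, map_smul, map_smul, smul_eq_mul, smul_eq_mul]

/-- from the para-orthogonal pairs `X̂ₙ, X̃ₙ` and the weights
`σ̂ₙ, σ̃ₙ`, the combinations `Ûₙ = σ̂ₙX̂ₙ − σ̃ₙX̃ₙ` and `Ũₙ = σ̃ₙX̂ₙ − σ̂ₙX̃ₙ`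
satisfy: (a) `Ûₙ` has constant term `1` and `Ũₙ` is monic of degree `n`;
(b) the orthogonality relations with common value `λₙ` at `k = n`;
(c) biorthogonality `⟨Ũₘ, Ûₙ*⟩ = λₙ δ_{m,n}`. -/
theorem stmt_9 (O : LaurentPolynomial ℂ →ₗ[ℂ] ℂ)
    (x0 lam υhat υtil σh σt : ℕ → ℂ)
    (hx0 : ∀ n, x0 n ≠ 0) (hυ : ∀ n, υhat n ^ 2 ≠ υtil n ^ 2)
    (Xh Xt : ℕ → Polynomial ℂ)
    (hXhdeg : ∀ n, (Xh n).natDegree = n) (hXh0 : ∀ n, (Xh n).coeff 0 = 1)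
    (hXtmonic : ∀ n, (Xt n).Monic) (hXtdeg : ∀ n, (Xt n).natDegree = n)
    (hOh0 : ∀ n ≥ 1, O ((Xh n).toLaurent) = υhat n / x0 n)
    (hOhmid : ∀ n ≥ 1, ∀ k : ℕ, 1 ≤ k → k ≤ n - 1 →
      O ((Xh n).toLaurent * LaurentPolynomial.T (-(k : ℤ))) = 0)
    (hOhn : ∀ n ≥ 1,
      O ((Xh n).toLaurent * LaurentPolynomial.T (-(n : ℤ))) = -υtil n / x0 n)
    (hOt0 : ∀ n ≥ 1, O ((Xt n).toLaurent) = υtil n / x0 n)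
    (hOtmid : ∀ n ≥ 1, ∀ k : ℕ, 1 ≤ k → k ≤ n - 1 →
      O ((Xt n).toLaurent * LaurentPolynomial.T (-(k : ℤ))) = 0)
    (hOtn : ∀ n ≥ 1,
      O ((Xt n).toLaurent * LaurentPolynomial.T (-(n : ℤ))) = -υhat n / x0 n)
    (hσh : ∀ n, σh n = x0 n * lam n * υhat n / (υhat n ^ 2 - υtil n ^ 2))
    (hσt : ∀ n, σt n = x0 n * lam n * υtil n / (υhat n ^ 2 - υtil n ^ 2))
    (hσtne : ∀ n, σt n ≠ 0)
    (hcoeffh : ∀ n ≥ 1, (Xh n).coeff n = (σh n + 1) / σt n)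
    (hcoefft : ∀ n ≥ 1, (Xt n).coeff 0 = (σh n - 1) / σt n)
    (Uh Ut : ℕ → Polynomial ℂ)
    (hUh : ∀ n, Uh n = C (σh n) * Xh n - C (σt n) * Xt n)
    (hUt : ∀ n, Ut n = C (σt n) * Xh n - C (σh n) * Xt n) :
    (∀ n ≥ 1, (Uh n).coeff 0 = 1 ∧ (Ut n).Monic ∧ (Ut n).natDegree = n) ∧
    (∀ n : ℕ, n ≥ 1 → ∀ k : ℕ, k ≤ n - 1 →
      O (LaurentPolynomial.T ((k : ℤ) - (n : ℤ)) * (Uh n).toLaurent) = 0 ∧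
      O ((Ut n).toLaurent * LaurentPolynomial.T (-(k : ℤ))) = 0) ∧
    (∀ n : ℕ, n ≥ 1 →
      O (LaurentPolynomial.T ((n : ℤ) - (n : ℤ)) * (Uh n).toLaurent) = lam n ∧
      O ((Ut n).toLaurent * LaurentPolynomial.T (-(n : ℤ))) = lam n) ∧
    (∀ m : ℕ, m ≥ 1 → ∀ n : ℕ, n ≥ 1 →
      O ((Ut m).toLaurent * LaurentPolynomial.T (-(n : ℤ)) * (Uh n).toLaurent)
        = if m = n then lam n else 0) := by
  have hne : ∀ n, υhat n ^ 2 - υtil n ^ 2 ≠ 0 := fun n => sub_ne_zero.mpr (hυ n)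
  have hUhdeg : ∀ n, (Uh n).natDegree ≤ n := by
    intro n
    rw [hUh]
    refine (natDegree_sub_le _ _).trans (max_le ?_ ?_)
    · exact (natDegree_C_mul_le _ _).trans (hXhdeg n).le
    · exact (natDegree_C_mul_le _ _).trans (hXtdeg n).le
  have hUtdeg : ∀ n, (Ut n).natDegree ≤ n := by
    intro n
    rw [hUt]
    refine (natDegree_sub_le _ _).trans (max_le ?_ ?_)
    · exact (natDegree_C_mul_le _ _).trans (hXhdeg n).le
    · exact (natDegree_C_mul_le _ _).trans (hXtdeg n).le
  have hUh0 : ∀ n ≥ 1, (Uh n).coeff 0 = 1 := by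
    intro n hn
    have := hσtne n
    rw [hUh, coeff_sub, coeff_C_mul, coeff_C_mul, hXh0, hcoefft n hn]
    field_simp
    ring
  have hUtn : ∀ n ≥ 1, (Ut n).coeff n = 1 := by
    intro n hn
    have := hσtne n
    have h1 : (Xt n).coeff n = 1 := by
      have := hXtmonic n
      rwa [Monic, leadingCoeff, hXtdeg n] at this
    rw [hUt, coeff_sub, coeff_C_mul, coeff_C_mul, h1, hcoeffh n hn]
    field_simp
    ring
  have e1 : ∀ n, σh n * (υhat n / x0 n) - σt n * (υtil n / x0 n) = lam n := by
    intro n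
    have := hne n
    have := hx0 n
    rw [hσh, hσt]
    field_simp
  have e2 : ∀ n, σh n * υtil n = σt n * υhat n := by
    intro n
    rw [hσh, hσt]
    ring
  have Uhz : ∀ n ≥ 1, ∀ j : ℕ, 1 ≤ j → j ≤ n →
      O ((Uh n).toLaurent * LaurentPolynomial.T (-(j : ℤ))) = 0 := by
    intro n hn j h1 h2
    rw [hUh, O_comb]
    rcases Nat.lt_or_ge j n with h | h
    · rw [hOhmid n hn j h1 (by omega), hOtmid n hn j h1 (by omega)]
      ring
    · obtain rfl : j = n := by omega
      rw [hOhn j hn, hOtn j hn]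
      linear_combination (-1 / x0 j) * e2 j
  have Uhl : ∀ n ≥ 1, O ((Uh n).toLaurent * LaurentPolynomial.T 0) = lam n := by
    intro n hn
    rw [hUh, O_comb, LaurentPolynomial.T_zero, mul_one, mul_one, hOh0 n hn, hOt0 n hn, e1]
  have Utz : ∀ n ≥ 1, ∀ k : ℕ, k < n →
      O ((Ut n).toLaurent * LaurentPolynomial.T (-(k : ℤ))) = 0 := by
    intro n hn k hk
    rw [hUt, O_comb]
    rcases Nat.eq_zero_or_pos k with h | h
    · subst h
      rw [Nat.cast_zero, neg_zero, LaurentPolynomial.T_zero, mul_one, mul_one, hOh0 n hn, hOt0 n hn]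
      linear_combination (-1 / x0 n) * e2 n
    · rw [hOhmid n hn k h (by omega), hOtmid n hn k h (by omega)]
      ring
  have Utl : ∀ n ≥ 1, O ((Ut n).toLaurent * LaurentPolynomial.T (-(n : ℤ))) = lam n := by
    intro n hn
    rw [hUt, O_comb, hOhn n hn, hOtn n hn]
    linear_combination e1 n
  refine ⟨fun n hn => ⟨hUh0 n hn, monic_of_natDegree_le_of_coeff_eq_one n (hUtdeg n) (hUtn n hn), ?_⟩,
    fun n hn k hk => ⟨?_, Utz n hn k (by omega)⟩, fun n hn => ⟨?_, Utl n hn⟩, ?_⟩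
  · refine natDegree_eq_of_le_of_coeff_ne_zero (hUtdeg n) ?_
    rw [hUtn n hn]
    exact one_ne_zero
  · have := Uhz n hn (n - k) (by omega) (by omega)
    rw [mul_comm]
    convert this using 4
    omega
  · rw [mul_comm, sub_self]
    exact Uhl n hn
  · intro m hm n hn
    rcases Nat.lt_or_ge m n with h | h
    · rw [if_neg (by omega), mul_assoc, mul_comm, O_mul_toLaurent O _ (Ut m) m (hUtdeg m)]
      refine Finset.sum_eq_zero fun i hi => ?_
      rw [Finset.mem_range] at hi
      have := Uhz n hn (n - i) (by omega) (by omega)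
      rw [mul_comm (LaurentPolynomial.T _) (toLaurent _), mul_assoc, ← LaurentPolynomial.T_add,
        show -(n : ℤ) + (i : ℤ) = -((n - i : ℕ) : ℤ) by omega, this, mul_zero]
    · rw [O_mul_toLaurent O _ (Uh n) n (hUhdeg n), Finset.sum_range_succ', hUh0 n hn,
        Finset.sum_eq_zero]
      · rw [Nat.cast_zero, LaurentPolynomial.T_zero, mul_one, one_mul, zero_add]
        split_ifs with h2
        · subst h2
          exact Utl m hm
        · exact Utz m hm n (by omega)
      · intro i hi
        rw [Finset.mem_range] at hi
        have := Utz m hm (n - (i + 1)) (by omega)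
        rw [mul_assoc, ← LaurentPolynomial.T_add,
          show -(n : ℤ) + ((i + 1 : ℕ) : ℤ) = -((n - (i + 1) : ℕ) : ℤ) by omega, this, mul_zero]
end

section
/- Let O be a ℂ-linear functional on ℂ[z, z^{−1}], and for n ≥ 0 let Û_n and Ũ_n be polynomials of degree n and λ_n, ρ̂_{n+1}, ρ̃_{n+1} nonzero complex numbers satisfying the difference equations Û_{n+1}(z) = Û_n(z) − ρ̂_{n+1}·z·Ũ_n(z) and Ũ_{n+1}(z) = z·Ũ_n(z) − ρ̃_{n+1}·Û_n(z). Suppose that for every n ≥ 0: O(z^{k−n}·Û_n(z)) = 0 and O(Ũ_n(z)·z^{−k}) = 0 for k = 0, …, n−1; O(Û_n(z)) = λ_n and O(Ũ_n(z)·z^{−n}) = λ_n; and additionally O(z^{−n}·Û_n(z)) = 0 for every n ≥ 1. Then λ_{n+1} = (1 − ρ̂_{n+1}ρ̃_{n+1})·λ_n for all n ≥ 0. -/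
open Polynomial

/-- under the difference equations
`Û_{n+1} = Ûₙ − ρ̂_{n+1} z Ũₙ` and `Ũ_{n+1} = z Ũₙ − ρ̃_{n+1} Ûₙ`
and the stated orthogonality relations for the functional `O`,
one has `λ_{n+1} = (1 − ρ̂_{n+1}ρ̃_{n+1}) λₙ` for all `n ≥ 0`. -/
theorem stmt_11 (O : LaurentPolynomial ℂ →ₗ[ℂ] ℂ)
    (Uh Ut : ℕ → Polynomial ℂ) (lam ρh ρt : ℕ → ℂ)
    (hUhdeg : ∀ n, (Uh n).natDegree = n) (hUtdeg : ∀ n, (Ut n).natDegree = n)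
    (hlamne : ∀ n, lam n ≠ 0) (hρhne : ∀ n, ρh (n + 1) ≠ 0) (hρtne : ∀ n, ρt (n + 1) ≠ 0)
    (hUh : ∀ n, Uh (n + 1) = Uh n - C (ρh (n + 1)) * X * Ut n)
    (hUt : ∀ n, Ut (n + 1) = X * Ut n - C (ρt (n + 1)) * Uh n)
    (hOh : ∀ n : ℕ, ∀ k : ℕ, k < n →
      O (LaurentPolynomial.T ((k : ℤ) - (n : ℤ)) * (Uh n).toLaurent) = 0)
    (hOt : ∀ n : ℕ, ∀ k : ℕ, k < n →
      O ((Ut n).toLaurent * LaurentPolynomial.T (-(k : ℤ))) = 0)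
    (hOh0 : ∀ n : ℕ, O ((Uh n).toLaurent) = lam n)
    (hOtn : ∀ n : ℕ, O ((Ut n).toLaurent * LaurentPolynomial.T (-(n : ℤ))) = lam n)
    (hOhn : ∀ n : ℕ, n ≥ 1 →
      O (LaurentPolynomial.T (-(n : ℤ)) * (Uh n).toLaurent) = 0) :
    ∀ n : ℕ, lam (n + 1) = (1 - ρh (n + 1) * ρt (n + 1)) * lam n := by
  intro n
  have key : ∀ (c : ℂ) (p : Polynomial ℂ),
      O ((Polynomial.C c * p).toLaurent) = c * O p.toLaurent := by
    intro c p
    rw [← Polynomial.smul_eq_C_mul, ← smul_eq_mul, ← map_smul]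
    congr 1
    rw [Polynomial.smul_eq_C_mul, map_mul, Polynomial.toLaurent_C,
      LaurentPolynomial.smul_eq_C_mul]
  have h1 := hOh0 (n + 1)
  rw [hUh, mul_assoc, map_sub, map_sub, key, hOh0] at h1
  have h2 := hOt (n + 1) 0 (Nat.succ_pos n)
  rw [hUt, Nat.cast_zero, neg_zero, LaurentPolynomial.T_zero, mul_one, map_sub, map_sub,
    key, hOh0] at h2
  linear_combination -h1 - ρh (n + 1) * h2
end

section
/- Let λ > −1/2 and η ∈ ℝ, and set b = λ + iη, so that b + conj(b) = 2λ. Then for every n ≥ 0 the following identity of polynomials in z holds: z·((2λ+2)_n/((b+2)_n))·F(−n, b+2; 2λ+2; 1−z) = ((2λ+2)_{n+1}/((b+1)_{n+1}))·F(−(n+1), b+1; 2λ+2; 1−z) − ((conj(b)+n+1)/(b+n+1))·((2λ+2)_n/((b+1)_n))·F(−n, b+1; 2λ+2; 1−z). -/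
open Polynomial

/-- The Pochhammer symbol `(x)_k` for a complex argument. -/
noncomputable def poch (x : ℂ) (k : ℕ) : ℂ := (ascPochhammer ℂ k).eval x

/-- The terminating Gauss hypergeometric polynomial
`F(−n, b; c; 1−z) = Σ_{k=0}^n ((−n)_k (b)_k)/((c)_k k!) (1−z)^k`, as a
polynomial in `z`. -/
noncomputable def hypF (n : ℕ) (b c : ℂ) : Polynomial ℂ :=
  ∑ k ∈ Finset.range (n + 1),
    Polynomial.C (poch (-(n : ℂ)) k * poch b k / (poch c k * (Nat.factorial k : ℂ)))
      * (1 - Polynomial.X) ^ k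

lemma poch_zero' (x : ℂ) : poch x 0 = 1 := by simp [poch]

lemma poch_succ_right' (x : ℂ) (k : ℕ) : poch x (k + 1) = poch x k * (x + k) := by
  simp [poch, ascPochhammer_succ_eval]

lemma poch_succ_left' (x : ℂ) (k : ℕ) : poch x (k + 1) = x * poch (x + 1) k := by
  simp [poch, ascPochhammer_succ_left]

lemma poch_ne_zero' (x : ℂ) (h : ∀ k : ℕ, x + k ≠ 0) (k : ℕ) : poch x k ≠ 0 := by
  induction k with
  | zero => simp [poch_zero']
  | succ k ih => rw [poch_succ_right']; exact mul_ne_zero ih (h k)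

lemma hypF_ext' (n : ℕ) (b c : ℂ) : hypF n b c = ∑ k ∈ Finset.range (n + 2),
    C (poch (-(n : ℂ)) k * poch b k / (poch c k * (Nat.factorial k : ℂ))) * (1 - X) ^ k := by
  rw [Finset.sum_range_succ, ← hypF, poch_succ_right' (-(n : ℂ))]
  simp

lemma contig' (n : ℕ) (c d : ℂ) (hc : ∀ k : ℕ, c + k ≠ 0) :
    C d * X * hypF n (d + 1) c
      = C (c + n) * hypF (n + 1) d c - C (c - d + n) * hypF n d c := by
  have e : C d * X * hypF n (d + 1) c
      = C d * hypF n (d + 1) c - C d * (1 - X) * hypF n (d + 1) c := by ring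
  have e2 : C d * (1 - X) * hypF n (d + 1) c = ∑ k ∈ Finset.range (n + 1),
      C d * (C (poch (-(n : ℂ)) k * poch (d + 1) k / (poch c k * (Nat.factorial k : ℂ)))
        * (1 - X) ^ (k + 1)) := by
    rw [hypF, Finset.mul_sum]
    refine Finset.sum_congr rfl fun k _ => ?_
    ring
  rw [e, e2, hypF_ext' n, hypF_ext' n, hypF, Finset.sum_range_succ' _ (n + 1),
    Finset.sum_range_succ' _ (n + 1), Finset.sum_range_succ' _ (n + 1)]
  simp only [mul_add, Finset.mul_sum, poch_zero']
  have key : ∀ k : ℕ,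
      C d * (C (poch (-(n : ℂ)) (k + 1) * poch (d + 1) (k + 1)
          / (poch c (k + 1) * (Nat.factorial (k + 1) : ℂ))) * (1 - X) ^ (k + 1))
      - C d * (C (poch (-(n : ℂ)) k * poch (d + 1) k / (poch c k * (Nat.factorial k : ℂ)))
        * (1 - X) ^ (k + 1))
      = C (c + n) * (C (poch (-((n + 1 : ℕ) : ℂ)) (k + 1) * poch d (k + 1)
          / (poch c (k + 1) * (Nat.factorial (k + 1) : ℂ))) * (1 - X) ^ (k + 1))
      - C (c - d + n) * (C (poch (-(n : ℂ)) (k + 1) * poch d (k + 1)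
          / (poch c (k + 1) * (Nat.factorial (k + 1) : ℂ))) * (1 - X) ^ (k + 1)) := by
    intro k
    simp only [← mul_assoc, ← C_mul, ← sub_mul, ← C_sub]
    congr 2
    have h1 : poch (-((n + 1 : ℕ) : ℂ)) (k + 1) = -((n : ℂ) + 1) * poch (-(n : ℂ)) k := by
      rw [poch_succ_left']
      push_cast
      congr 2
      ring
    rw [h1, poch_succ_left' d, poch_succ_right' (-(n : ℂ)), poch_succ_right' (d + 1),
      poch_succ_right' c, Nat.factorial_succ]
    have h2 := poch_ne_zero' c hc k
    have h3 := hc k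
    have h4 : (Nat.factorial k : ℂ) ≠ 0 := by exact_mod_cast Nat.factorial_ne_zero k
    have h5 : (k : ℂ) + 1 ≠ 0 := by exact_mod_cast Nat.succ_ne_zero k
    push_cast
    field_simp
    ring
  have key2 := Finset.sum_congr (rfl : Finset.range (n + 1) = _) fun k _ => key k
  rw [Finset.sum_sub_distrib, Finset.sum_sub_distrib] at key2
  have h0 : (C d : ℂ[X]) = C (c + n) - C (c - d + n) := by
    rw [← C_sub]; congr 1; ring
  simp only [pow_zero, Nat.factorial_zero, Nat.cast_one, mul_one, div_one, C_1]
  linear_combination key2 + h0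

/-- the contiguous-type identity
`z·((2λ+2)ₙ/(b+2)ₙ)·F(−n, b+2; 2λ+2; 1−z)
  = ((2λ+2)_{n+1}/(b+1)_{n+1})·F(−(n+1), b+1; 2λ+2; 1−z)
    − ((conj b + n + 1)/(b + n + 1))·((2λ+2)ₙ/(b+1)ₙ)·F(−n, b+1; 2λ+2; 1−z)`. -/
theorem stmt_17 (lam η : ℝ) (hlam : lam > -1/2)
    (b : ℂ) (hb : b = (lam : ℂ) + (η : ℂ) * Complex.I) :
    ∀ n : ℕ,
      X * C (poch (2 * (lam : ℂ) + 2) n / poch (b + 2) n) * hypF n (b + 2) (2 * (lam : ℂ) + 2)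
        = C (poch (2 * (lam : ℂ) + 2) (n + 1) / poch (b + 1) (n + 1))
            * hypF (n + 1) (b + 1) (2 * (lam : ℂ) + 2)
          - C (((starRingEnd ℂ) b + (n : ℂ) + 1) / (b + (n : ℂ) + 1)
                * (poch (2 * (lam : ℂ) + 2) n / poch (b + 1) n))
            * hypF n (b + 1) (2 * (lam : ℂ) + 2) := by
  intro n
  have hc : ∀ k : ℕ, 2 * (lam : ℂ) + 2 + k ≠ 0 := by
    intro k h
    have := congrArg Complex.re h
    simp at this
    have hk : (0 : ℝ) ≤ k := k.cast_nonneg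
    linarith
  have hd : ∀ k : ℕ, b + 1 + k ≠ 0 := by
    intro k h
    have := congrArg Complex.re h
    simp [hb] at this
    have hk : (0 : ℝ) ≤ k := k.cast_nonneg
    linarith
  have hcb : (starRingEnd ℂ) b = 2 * (lam : ℂ) - b := by
    rw [hb]; simp; ring
  have H := contig' n (2 * (lam : ℂ) + 2) (b + 1) hc
  rw [show b + 1 + 1 = b + 2 by ring] at H
  have hD := poch_ne_zero' _ hd n
  have hD1 := poch_ne_zero' _ hd (n + 1)
  have hn := hd n
  have hl : poch (b + 1) (n + 1) = (b + 1) * poch (b + 2) n := by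
    rw [poch_succ_left', show b + 1 + 1 = b + 2 by ring]
  have hr := poch_succ_right' (b + 1) n
  have hb1 : b + 1 ≠ 0 := by simpa using hd 0
  have hE : poch (b + 2) n ≠ 0 := fun h => hD1 (by rw [hl, h, mul_zero])
  have hn' : b + n + 1 ≠ 0 := by
    rw [show b + n + 1 = b + 1 + n by ring]; exact hn
  set q := poch (2 * (lam : ℂ) + 2) n / poch (b + 1) (n + 1) with hq
  have e1 : poch (2 * (lam : ℂ) + 2) n / poch (b + 2) n = q * (b + 1) := by
    rw [hq, hl]; field_simp
  have e2 : poch (2 * (lam : ℂ) + 2) (n + 1) / poch (b + 1) (n + 1)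
      = q * (2 * (lam : ℂ) + 2 + n) := by
    rw [hq, poch_succ_right' (2 * (lam : ℂ) + 2)]; ring
  have e3 : ((starRingEnd ℂ) b + (n : ℂ) + 1) / (b + (n : ℂ) + 1)
      * (poch (2 * (lam : ℂ) + 2) n / poch (b + 1) n)
      = q * (2 * (lam : ℂ) + 2 - (b + 1) + n) := by
    rw [hq, hr, hcb, show b + 1 + (n : ℂ) = b + n + 1 by ring]
    field_simp
    ring
  rw [e1, e2, e3, C_mul, C_mul, C_mul]
  linear_combination C q * H
end

section
/- Fix n ≥ 1 and suppose B_n(ζ) ≠ 0, B_{n−1}(ζ) ≠ 0, ω_n(ζ) ≠ 0, and X_n^{(ζ)}(ζ) = 0 (equivalently ω_n(ζ) = −B_n(ζ)/B_{n−1}(ζ)). Then X_{n+1}^{(ζ)}(ζ) = 0 if and only if ω_{n+1}(ζ) = ((β_n − ζ)ω_n(ζ) − τ_n ζ)/ω_n(ζ). Consequently, the polynomials X_n^{(ζ)} and X_{n+1}^{(ζ)} have the common zero ζ for all n ≥ 1 exactly when ω_1(ζ) = β_0 − ζ and the ω_n(ζ) satisfy this recursion for all n ≥ 1. -/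
open Polynomial

/-- for `n ≥ 1` with `Bₙ(ζ) ≠ 0`, `B_{n−1}(ζ) ≠ 0`, `ωₙ(ζ) ≠ 0`
and `Xₙ(ζ) = 0`, one has `X_{n+1}(ζ) = 0` iff
`ω_{n+1}(ζ) = ((βₙ − ζ)ωₙ(ζ) − τₙζ)/ωₙ(ζ)`.  Consequently `Xₙ` and `X_{n+1}`
have the common zero `ζ` for all `n ≥ 1` exactly when `ω₁(ζ) = β₀ − ζ` and the
recursion holds for all `n ≥ 1`. -/
theorem stmt_19 (β τ ω : ℕ → ℂ) (ζ : ℂ)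
    (hτ : ∀ n, τ n ≠ 0)
    (B Xp : ℕ → Polynomial ℂ)
    (hB0 : B 0 = 1)
    (hB1 : B 1 = X - C (β 0))
    (hBrec : ∀ n, B (n + 2) = (X - C (β (n + 1))) * B (n + 1) - C (τ (n + 1)) * X * B n)
    (hX0 : Xp 0 = 1)
    (hXsucc : ∀ n, Xp (n + 1) = B (n + 1) + C (ω (n + 1)) * B n) :
    (∀ n : ℕ, n ≥ 1 →
      (B n).eval ζ ≠ 0 → (B (n - 1)).eval ζ ≠ 0 → ω n ≠ 0 →
      (Xp n).eval ζ = 0 →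
      ((Xp (n + 1)).eval ζ = 0 ↔
        ω (n + 1) = ((β n - ζ) * ω n - τ n * ζ) / ω n)) ∧
    ((∀ n, (B n).eval ζ ≠ 0) → (∀ n : ℕ, n ≥ 1 → ω n ≠ 0) →
      ((∀ n : ℕ, n ≥ 1 → (Xp n).eval ζ = 0 ∧ (Xp (n + 1)).eval ζ = 0) ↔
        (ω 1 = β 0 - ζ ∧
          ∀ n : ℕ, n ≥ 1 → ω (n + 1) = ((β n - ζ) * ω n - τ n * ζ) / ω n))) := by
  have key : ∀ n : ℕ, n ≥ 1 →
      (B n).eval ζ ≠ 0 → (B (n - 1)).eval ζ ≠ 0 → ω n ≠ 0 →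
      (Xp n).eval ζ = 0 →
      ((Xp (n + 1)).eval ζ = 0 ↔
        ω (n + 1) = ((β n - ζ) * ω n - τ n * ζ) / ω n) := by
    intro n hn _ hb hw hx
    obtain ⟨m, rfl⟩ : ∃ m, n = m + 1 := ⟨n - 1, by omega⟩
    simp only [Nat.add_sub_cancel] at hb
    rw [hXsucc m] at hx
    rw [hXsucc (m + 1), hBrec m, eq_div_iff hw]
    simp only [eval_add, eval_sub, eval_mul, eval_X, eval_C] at hx ⊢
    constructor
    · intro h
      apply mul_right_cancel₀ hb
      linear_combination (ζ - β (m + 1) + ω (m + 1 + 1)) * hx - h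
    · intro h
      linear_combination (ζ - β (m + 1) + ω (m + 1 + 1)) * hx - (B m).eval ζ * h
  have h1 : (Xp 1).eval ζ = 0 ↔ ω 1 = β 0 - ζ := by
    rw [hXsucc 0, hB0, zero_add, hB1]
    simp only [eval_add, eval_sub, eval_mul, eval_X, eval_C, eval_one]
    constructor
    · intro h
      linear_combination h
    · intro h
      linear_combination h
  refine ⟨key, fun hB hw => ⟨fun h => ⟨h1.1 (h 1 le_rfl).1, fun n hn => ?_⟩, fun h => ?_⟩⟩
  · exact (key n hn (hB n) (hB _) (hw n hn) (h n hn).1).1 (h n hn).2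
  · have hz : ∀ n : ℕ, n ≥ 1 → (Xp n).eval ζ = 0 := by
      intro n hn
      induction n, hn using Nat.le_induction with
      | base => exact h1.2 h.1
      | succ n hn ih => exact (key n hn (hB n) (hB _) (hw n hn) ih).2 (h.2 n hn)
    exact fun n hn => ⟨hz n hn, hz (n + 1) (by omega)⟩
end
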